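/- Let k be a field, V a finite-dimensional k-vector space, and N : V → V a nilpotent linear endomorphism. Then there exists a unique finite increasing filtration (F_i)_{i ∈ ℤ} of V by subspaces, with F_i = 0 for i sufficiently small and F_i = V for i sufficiently large, such that N(F_i) ⊆ F_{i-2} for all i, and such that for every i ≥ 0 the i-th iterate N^i induces an isomorphism from the graded piece Gr_i = F_i / F_{i-1} onto Gr_{-i} = F_{-i} / F_{-i-1}. -/

import Mathlib

/-- `F` is a monodromy filtration for the nilpotent endomorphism `N`: a finite
increasing filtration, exhaustive and separated, with `N (F i) ⊆ F (i - 2)`, such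
that for each `i ≥ 0` the `i`-th iterate `N^i` induces an isomorphism
`Gr_i = F i / F (i-1) → Gr_{-i} = F (-i) / F (-i-1)` (stated elementwise as
injectivity and surjectivity of the induced map on graded pieces). -/
def IsMonodromyFiltration {k V : Type*} [Field k] [AddCommGroup V] [Module k V]
    (N : Module.End k V) (F : ℤ → Submodule k V) : Prop :=
  Monotone F ∧
    (∃ a : ℤ, ∀ i ≤ a, F i = ⊥) ∧
    (∃ b : ℤ, ∀ i, b ≤ i → F i = ⊤) ∧
    (∀ i : ℤ, ∀ v ∈ F i, N v ∈ F (i - 2)) ∧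
    (∀ i : ℕ,
      (∀ v ∈ F (i : ℤ), (N ^ i) v ∈ F (-(i : ℤ) - 1) → v ∈ F ((i : ℤ) - 1)) ∧
      (∀ w ∈ F (-(i : ℤ)), ∃ v ∈ F (i : ℤ), (N ^ i) v - w ∈ F (-(i : ℤ) - 1)))

namespace MonodromyFiltration

section Construction

variable {k V : Type*} [Field k] [AddCommGroup V] [Module k V] (N : Module.End k V)

/-- The filtration `F i = ∑ j, N^j (ker N^(i + 2j + 1))`, where kernels of powers with negative
exponent are zero. -/
def kernelFiltration (i : ℤ) : Submodule k V :=
  ⨆ j : ℕ, (LinearMap.ker (N ^ (i + 2 * j + 1).toNat)).map (N ^ j)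

variable {N}

lemma pow_apply_eq_zero_of_le {m n : ℕ} (h : m ≤ n) {v : V} (hv : (N ^ m) v = 0) :
    (N ^ n) v = 0 := by
  rw [← Nat.sub_add_cancel h, pow_add, Module.End.mul_apply, hv, map_zero]

lemma pow_apply_mem_kernelFiltration {i : ℤ} (j : ℕ) {v : V}
    (hv : (N ^ (i + 2 * j + 1).toNat) v = 0) : (N ^ j) v ∈ kernelFiltration N i :=
  Submodule.mem_iSup_of_mem j (Submodule.mem_map_of_mem hv)

lemma kernelFiltration_le {i : ℤ} {S : Submodule k V}
    (h : ∀ (j : ℕ) (v : V), (N ^ (i + 2 * j + 1).toNat) v = 0 → (N ^ j) v ∈ S) :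
    kernelFiltration N i ≤ S := by
  refine iSup_le fun j => ?_
  rintro _ ⟨v, hv, rfl⟩
  exact h j v hv

lemma mem_kernelFiltration_of_pow_eq_zero {i : ℤ} {v : V} (hv : (N ^ (i + 1).toNat) v = 0) :
    v ∈ kernelFiltration N i := by
  simpa using pow_apply_mem_kernelFiltration (N := N) (i := i) 0 (v := v) (by simpa using hv)

lemma kernelFiltration_mono : Monotone (kernelFiltration N) := fun _ _ hab =>
  kernelFiltration_le fun j _ hv =>
    pow_apply_mem_kernelFiltration j (pow_apply_eq_zero_of_le (by omega) hv)

lemma apply_mem_kernelFiltration {i : ℤ} {v : V} (hv : v ∈ kernelFiltration N i) :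
    N v ∈ kernelFiltration N (i - 2) := by
  suffices h : kernelFiltration N i ≤ (kernelFiltration N (i - 2)).comap N from h hv
  refine kernelFiltration_le fun j v hv => ?_
  rw [Submodule.mem_comap, ← Module.End.mul_apply, ← pow_succ']
  exact pow_apply_mem_kernelFiltration _ (pow_apply_eq_zero_of_le (by omega) hv)

lemma kernelFiltration_neg_le (i : ℕ) :
    kernelFiltration N (-(i : ℤ)) ≤ (kernelFiltration N i).map (N ^ i) := by
  refine kernelFiltration_le fun j v hv => ?_
  rcases le_or_gt i j with h | h
  · obtain ⟨l, rfl⟩ := Nat.exists_eq_add_of_le h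
    rw [pow_add, Module.End.mul_apply]
    exact Submodule.mem_map_of_mem
      (pow_apply_mem_kernelFiltration l (pow_apply_eq_zero_of_le (by omega) hv))
  · rw [pow_apply_eq_zero_of_le (by omega) hv]
    exact zero_mem _

/-- Elements whose image under `N^i` lies in `N^(i+1) (F (i+1))` lie in `F (i-1)`. -/
lemma mem_kernelFiltration_sub_one {i : ℕ} {v : V}
    (hv : (N ^ i) v ∈ (kernelFiltration N (i + 1)).map (N ^ (i + 1))) :
    v ∈ kernelFiltration N (i - 1) := by
  obtain ⟨w, hw, hwv⟩ := hv
  have hNw : N w ∈ kernelFiltration N ((i : ℤ) - 1) := by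
    convert apply_mem_kernelFiltration hw using 2
    ring
  rw [← sub_add_cancel v (N w)]
  refine add_mem (mem_kernelFiltration_of_pow_eq_zero ?_) hNw
  rw [pow_succ, Module.End.mul_apply] at hwv
  simp [hwv]

lemma isMonodromyFiltration_kernelFiltration (hN : IsNilpotent N) :
    IsMonodromyFiltration N (kernelFiltration N) := by
  obtain ⟨d, hd⟩ := hN
  have hd0 (v : V) : (N ^ d) v = 0 := by simp [hd]
  refine ⟨kernelFiltration_mono, ⟨-d, fun i hi => ?_⟩, ⟨d, fun i hi => ?_⟩,
    fun i v hv => apply_mem_kernelFiltration hv, fun i => ⟨fun v _ hv => ?_, fun w hw => ?_⟩⟩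
  · refine le_bot_iff.1 (kernelFiltration_le fun j v hv => (Submodule.mem_bot k).2 ?_)
    rcases le_or_gt d j with h | h
    · exact pow_apply_eq_zero_of_le h (hd0 v)
    · exact pow_apply_eq_zero_of_le (by omega) hv
  · exact eq_top_iff.2 fun v _ =>
      mem_kernelFiltration_of_pow_eq_zero (pow_apply_eq_zero_of_le (by omega) (hd0 v))
  · refine mem_kernelFiltration_sub_one ?_
    have h := kernelFiltration_neg_le (N := N) (i + 1)
    push_cast at h
    exact h (by convert hv using 2; ring)
  · obtain ⟨v, hv, rfl⟩ := kernelFiltration_neg_le i hw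
    exact ⟨v, hv, by simp⟩

end Construction

section Uniqueness

variable {k V : Type*} [Field k] [AddCommGroup V] [Module k V] {N : Module.End k V}
  {F : ℤ → Submodule k V}

lemma pow_apply_mem (hF : IsMonodromyFiltration N F) (j : ℕ) {i : ℤ} {v : V} (hv : v ∈ F i) :
    (N ^ j) v ∈ F (i - 2 * j) := by
  induction j with
  | zero => simpa using hv
  | succ j ih =>
    rw [pow_succ', Module.End.mul_apply]
    convert hF.2.2.2.1 _ _ ih using 2
    push_cast
    ring

lemma mem_of_pow_eq_zero (hF : IsMonodromyFiltration N F) {i : ℤ} {v : V}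
    (hv : (N ^ (i + 1).toNat) v = 0) : v ∈ F i := by
  obtain ⟨b, hb⟩ := hF.2.2.1
  rcases lt_or_ge i (-1) with hi | hi
  · have : v = 0 := by simpa [Int.toNat_of_nonpos (show i + 1 ≤ 0 by omega)] using hv
    exact this ▸ zero_mem _
  · have key : ∀ n : ℕ, ∀ m : ℤ, i ≤ m → b ≤ m + n → v ∈ F m := by
      intro n
      induction n with
      | zero => intro m _ hm; rw [hb m (by simpa using hm)]; trivial
      | succ n ih =>
        intro m him hm
        obtain ⟨l, hl⟩ := Int.eq_ofNat_of_zero_le (show 0 ≤ m + 1 by omega)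
        have h1 : v ∈ F (l : ℤ) := by
          rw [← hl]
          exact ih _ (by omega) (by push_cast at hm; omega)
        have h2 := (hF.2.2.2.2 l).1 v h1
          (by rw [pow_apply_eq_zero_of_le (by omega) hv]; exact zero_mem _)
        rwa [← hl, add_sub_cancel_right] at h2
    exact key (b - i).toNat i le_rfl (by omega)

lemma kernelFiltration_le_of_isMonodromyFiltration (hF : IsMonodromyFiltration N F) (i : ℤ) :
    kernelFiltration N i ≤ F i := by
  refine kernelFiltration_le fun j v hv => ?_
  convert pow_apply_mem hF j (mem_of_pow_eq_zero hF hv) using 2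
  ring

lemma neg_le_map_pow (hF : IsMonodromyFiltration N F) (i : ℕ) :
    F (-(i : ℤ)) ≤ (F i).map (N ^ i) := by
  obtain ⟨a, ha⟩ := hF.2.1
  have key : ∀ n i : ℕ, -(i : ℤ) ≤ a + n → F (-(i : ℤ)) ≤ (F i).map (N ^ i) := by
    intro n
    induction n with
    | zero => intro i hi; rw [ha _ (by simpa using hi)]; exact bot_le
    | succ n ih =>
      intro i hi w hw
      obtain ⟨v, hv, hvw⟩ := (hF.2.2.2.2 i).2 w hw
      obtain ⟨u, hu, huw⟩ := ih (i + 1) (by push_cast at hi ⊢; omega)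
        (by convert hvw using 2; push_cast; ring)
      refine ⟨v - N u, sub_mem hv (hF.1 ?_ (hF.2.2.2.1 _ _ hu)), ?_⟩
      · push_cast; omega
      · rw [pow_succ, Module.End.mul_apply] at huw
        rw [map_sub, huw, sub_sub_cancel]
  exact key (-(i : ℤ) - a).toNat i (by omega)

lemma le_kernelFiltration (hN : IsNilpotent N) (hF : IsMonodromyFiltration N F) (i : ℤ) :
    F i ≤ kernelFiltration N i := by
  obtain ⟨b, hb⟩ := (isMonodromyFiltration_kernelFiltration hN).2.2.1
  have key : ∀ n : ℕ, ∀ m : ℤ, -1 ≤ m → b ≤ m + n → F m ≤ kernelFiltration N m := by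
    intro n
    induction n with
    | zero => intro m _ hm; rw [hb m (by simpa using hm)]; exact le_top
    | succ n ih =>
      intro m h0 hm v hv
      obtain ⟨l, hl⟩ := Int.eq_ofNat_of_zero_le (show 0 ≤ m + 1 by omega)
      obtain rfl : m = l - 1 := by omega
      refine mem_kernelFiltration_sub_one (Submodule.map_mono
        (ih (l + 1) (by omega) (by push_cast at hm; omega)) ?_)
      have h := neg_le_map_pow hF (l + 1)
      push_cast at h
      exact h (by convert pow_apply_mem hF l hv using 2; ring)
  rcases le_total 0 i with hi | hi
  · exact key (b - i).toNat i (by omega) (by omega)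
  · obtain ⟨l, rfl⟩ := Int.exists_eq_neg_ofNat hi
    intro v hv
    obtain ⟨w, hw, rfl⟩ := neg_le_map_pow hF l hv
    convert pow_apply_mem (isMonodromyFiltration_kernelFiltration hN) l
      (key (b - l).toNat l (by omega) (by omega) hw) using 2
    ring

end Uniqueness

end MonodromyFiltration

/-- Existence and uniqueness of the monodromy filtration of a nilpotent endomorphism
of a finite-dimensional vector space. -/
theorem existsUnique_monodromy_filtration {k V : Type*} [Field k] [AddCommGroup V]
    [Module k V] [FiniteDimensional k V] (N : Module.End k V) (hN : IsNilpotent N) :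
    ∃! F : ℤ → Submodule k V, IsMonodromyFiltration N F := by
  open MonodromyFiltration in
  exact ⟨kernelFiltration N, isMonodromyFiltration_kernelFiltration hN, fun F hF =>
    funext fun i => le_antisymm (le_kernelFiltration hN hF i)
      (kernelFiltration_le_of_isMonodromyFiltration hF i)⟩
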